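/- (Single-letter content of Theorem 4.) Let 0 < N1 ≤ 1/2 and 0 < N2 ≤ 1/2, let Q ∈ [0,1], and for each P ∈ [0,1] let X, S, η1, η2 be mutually independent ZMod 2-valued random variables with Pr{X=1}=P, Pr{S=1}=Q, Pr{η1=1}=N1, Pr{η2=1}=N2; set Y = X + S + η1 and Z = X + S + η2 (addition in ZMod 2). Then the supremum over P ∈ [0,1] of I(X; Y | S) - I(X; Z | S) equals max{0, h(N2) - h(N1)}, where h is the binary entropy function. -/

import Mathlib

open MeasureTheory Real

/-- Shannon entropy of a finitely-valued random variable `X` under measure `μ`. -/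
noncomputable def ent {Ω α : Type*} [MeasurableSpace Ω] [Fintype α]
    (μ : Measure Ω) (X : Ω → α) : ℝ :=
  ∑ x : α, Real.negMulLog (μ (X ⁻¹' {x})).toReal

/-- Conditional Shannon entropy `H(X | Y) = H(X, Y) - H(Y)`. -/
noncomputable def condEnt {Ω α β : Type*} [MeasurableSpace Ω] [Fintype α] [Fintype β]
    (μ : Measure Ω) (X : Ω → α) (Y : Ω → β) : ℝ :=
  ent μ (fun ω => (X ω, Y ω)) - ent μ Y

/-- Mutual information `I(X; Y) = H(X) + H(Y) - H(X, Y)`. -/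
noncomputable def mutInfo {Ω α β : Type*} [MeasurableSpace Ω] [Fintype α] [Fintype β]
    (μ : Measure Ω) (X : Ω → α) (Y : Ω → β) : ℝ :=
  ent μ X + ent μ Y - ent μ (fun ω => (X ω, Y ω))

/-- Conditional mutual information `I(X; Y | Z) = H(X|Z) + H(Y|Z) - H(X,Y|Z)`. -/
noncomputable def condMutInfo {Ω α β γ : Type*} [MeasurableSpace Ω]
    [Fintype α] [Fintype β] [Fintype γ]
    (μ : Measure Ω) (X : Ω → α) (Y : Ω → β) (Z : Ω → γ) : ℝ :=
  condEnt μ X Z + condEnt μ Y Z - condEnt μ (fun ω => (X ω, Y ω)) Z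

instance : MeasurableSpace (ZMod 2) := ⊤
instance : MeasurableSingletonClass (ZMod 2) :=
  ⟨fun _ => MeasurableSpace.measurableSet_top⟩

/-- The binary entropy function `h(p) = -p log p - (1-p) log (1-p)`,
with the convention `h(0) = h(1) = 0`. -/
noncomputable def binEnt (p : ℝ) : ℝ := Real.negMulLog p + Real.negMulLog (1 - p)

/-- `A`, `B`, `C`, `D` are mutually independent (elementary form for
finitely-valued random variables). -/
def IndepFin4 {Ω α β γ δ : Type*} [MeasurableSpace Ω] (μ : MeasureTheory.Measure Ω)
    (A : Ω → α) (B : Ω → β) (C : Ω → γ) (D : Ω → δ) : Prop :=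
  ∀ a b c d, μ (A ⁻¹' {a} ∩ B ⁻¹' {b} ∩ C ⁻¹' {c} ∩ D ⁻¹' {d}) =
    μ (A ⁻¹' {a}) * μ (B ⁻¹' {b}) * μ (C ⁻¹' {c}) * μ (D ⁻¹' {d})

/-- A set splits according to the two values of a binary random variable. -/
lemma measure_toReal_eq_add_of_zmod_two {Ω : Type*} [MeasurableSpace Ω] (μ : Measure Ω)
    [IsProbabilityMeasure μ] {D : Ω → ZMod 2} (hD : Measurable D) (A : Set Ω) :
    (μ A).toReal = (μ (A ∩ D ⁻¹' {0})).toReal + (μ (A ∩ D ⁻¹' {1})).toReal := by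
  have hset : A ∩ D ⁻¹' {1} = A \ D ⁻¹' {0} := by
    ext ω
    simp only [Set.mem_inter_iff, Set.mem_preimage, Set.mem_singleton_iff, Set.mem_sdiff]
    generalize D ω = d
    revert d
    have key : ∀ d : ZMod 2, d = 1 ↔ ¬ d = 0 := by decide
    intro d
    rw [key d]
  rw [hset, ← ENNReal.toReal_add (measure_ne_top _ _) (measure_ne_top _ _),
    measure_inter_add_sdiff A (hD (measurableSet_singleton 0))]

lemma measure_preimage_zero_toReal {Ω : Type*} [MeasurableSpace Ω] (μ : Measure Ω)
    [IsProbabilityMeasure μ] {D : Ω → ZMod 2} (hD : Measurable D) :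
    (μ (D ⁻¹' {0})).toReal = 1 - (μ (D ⁻¹' {1})).toReal := by
  have h := measure_toReal_eq_add_of_zmod_two μ hD Set.univ
  simp only [Set.univ_inter, measure_univ, ENNReal.toReal_one] at h
  linarith

/-- Over `ZMod 2`, `I(X; X + S + E | S) = h(P * N) - h(N)` for independent `X`, `S`, `E`, where
`P * N` denotes binary convolution. -/
lemma condMutInfo_add_noise {Ω : Type*} [MeasurableSpace Ω] (μ : Measure Ω)
    [IsProbabilityMeasure μ] {X S E : Ω → ZMod 2}
    (hX : Measurable X) (hS : Measurable S) (hE : Measurable E) {p q n : ℝ}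
    (hind : ∀ x s e, (μ (X ⁻¹' {x} ∩ S ⁻¹' {s} ∩ E ⁻¹' {e})).toReal =
      (μ (X ⁻¹' {x})).toReal * (μ (S ⁻¹' {s})).toReal * (μ (E ⁻¹' {e})).toReal)
    (hp : (μ (X ⁻¹' {1})).toReal = p) (hq : (μ (S ⁻¹' {1})).toReal = q)
    (hn : (μ (E ⁻¹' {1})).toReal = n) :
    condMutInfo μ X (fun ω => X ω + S ω + E ω) S =
      binEnt (p * (1 - n) + (1 - p) * n) - binEnt n := by
  have hp0 := measure_preimage_zero_toReal μ hX
  have hq0 := measure_preimage_zero_toReal μ hS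
  have hn0 := measure_preimage_zero_toReal μ hE
  rw [hp] at hp0
  rw [hq] at hq0
  rw [hn] at hn0
  have hXS : ∀ x s, (μ ((fun ω => (X ω, S ω)) ⁻¹' {(x, s)})).toReal =
      (μ (X ⁻¹' {x})).toReal * (μ (S ⁻¹' {s})).toReal := by
    intro x s
    have hset : (fun ω => (X ω, S ω)) ⁻¹' {(x, s)} = X ⁻¹' {x} ∩ S ⁻¹' {s} := by
      ext ω; simp
    rw [hset, measure_toReal_eq_add_of_zmod_two μ hE, hind, hind, hn0, hn]
    ring
  have hXYS : ∀ x y s,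
      (μ ((fun ω => ((X ω, X ω + S ω + E ω), S ω)) ⁻¹' {((x, y), s)})).toReal =
      (μ (X ⁻¹' {x})).toReal * (μ (S ⁻¹' {s})).toReal * (μ (E ⁻¹' {x + s + y})).toReal := by
    intro x y s
    rw [← hind]
    congr 2
    ext ω
    simp only [Set.mem_preimage, Set.mem_singleton_iff, Set.mem_inter_iff, Prod.mk.injEq]
    generalize X ω = a
    generalize S ω = b
    generalize E ω = c
    revert a b c x y s
    decide
  have hYS : ∀ y s, (μ ((fun ω => (X ω + S ω + E ω, S ω)) ⁻¹' {(y, s)})).toReal =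
      (μ (S ⁻¹' {s})).toReal * ((1 - p) * (μ (E ⁻¹' {s + y})).toReal +
        p * (μ (E ⁻¹' {1 + s + y})).toReal) := by
    intro y s
    have hset : ∀ x, (fun ω => (X ω + S ω + E ω, S ω)) ⁻¹' {(y, s)} ∩ X ⁻¹' {x} =
        (fun ω => ((X ω, X ω + S ω + E ω), S ω)) ⁻¹' {((x, y), s)} := by
      intro x
      ext ω
      simp only [Set.mem_preimage, Set.mem_singleton_iff, Set.mem_inter_iff, Prod.mk.injEq]
      tauto
    rw [measure_toReal_eq_add_of_zmod_two μ hX, hset, hset, hXYS, hXYS, hp0, hp, zero_add]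
    ring
  have hsum : ∀ f : ZMod 2 → ℝ, ∑ x, f x = f 0 + f 1 := fun f => Fin.sum_univ_two f
  have h11 : (1 : ZMod 2) + 1 = 0 := by decide
  have hr : 1 - ((1 - p) * n + p * (1 - n)) = (1 - p) * (1 - n) + p * n := by ring
  have hr' : p * (1 - n) + (1 - p) * n = (1 - p) * n + p * (1 - n) := by ring
  simp only [condMutInfo, condEnt, ent, binEnt, Fintype.sum_prod_type, hsum, hXS, hXYS, hYS,
    add_zero, zero_add, h11, hp0, hq0, hn0, hp, hq, hn, negMulLog_mul, hr, hr']
  ring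

lemma binEnt_eq_binEntropy : binEnt = binEntropy := by
  funext p
  rw [binEnt, binEntropy_eq_negMulLog_add_negMulLog_one_sub]

/-- The four-point inequality for concave functions. -/
lemma ConcaveOn.add_le_add_of_add_eq {s : Set ℝ} {f : ℝ → ℝ} (hf : ConcaveOn ℝ s f)
    {a b c d : ℝ} (ha : a ∈ s) (hd : d ∈ s) (hab : a ≤ b) (hac : a ≤ c)
    (h : a + d = b + c) : f a + f d ≤ f b + f c := by
  rcases eq_or_lt_of_le (show a ≤ d by linarith) with had | had
  · obtain rfl : b = a := by linarith
    obtain rfl : d = c := by linarith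
    exact le_rfl
  · have hpos : 0 < d - a := sub_pos.2 had
    have hb : b = (d - b) / (d - a) * a + (b - a) / (d - a) * d := by field_simp; ring
    have hc : c = (b - a) / (d - a) * a + (d - b) / (d - a) * d := by
      field_simp
      linear_combination (a - d) * h
    have hw : (d - b) / (d - a) + (b - a) / (d - a) = 1 := by field_simp; ring
    have h1 : 0 ≤ (d - b) / (d - a) := div_nonneg (by linarith) hpos.le
    have h2 : 0 ≤ (b - a) / (d - a) := div_nonneg (by linarith) hpos.le
    have e1 := hf.2 ha hd h1 h2 hw
    have e2 := hf.2 ha hd h2 h1 (by linarith)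
    simp only [smul_eq_mul] at e1 e2
    rw [← hb] at e1
    rw [← hc] at e2
    calc f a + f d = ((d - b) / (d - a) + (b - a) / (d - a)) * (f a + f d) := by
          rw [hw, one_mul]
      _ ≤ f b + f c := by linarith

lemma binEntropy_conv_one_sub (P N : ℝ) :
    binEntropy ((1 - P) * (1 - N) + (1 - (1 - P)) * N) =
      binEntropy (P * (1 - N) + (1 - P) * N) := by
  rw [← binEntropy_one_sub]
  congr 1
  ring

/-- Convolving with a bit of parameter `P ≤ 1/2` keeps `h` monotone on `[0, 1/2]`, and does not
expand its increments. -/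
lemma binEntropy_conv_of_le_half {P M N : ℝ} (hP : 0 ≤ P) (hP' : P ≤ 1 / 2) (hM : 0 ≤ M)
    (hMN : M ≤ N) (hN : N ≤ 1 / 2) :
    binEntropy (P * (1 - M) + (1 - P) * M) ≤ binEntropy (P * (1 - N) + (1 - P) * N) ∧
      binEntropy (P * (1 - N) + (1 - P) * N) - binEntropy N ≤
        binEntropy (P * (1 - M) + (1 - P) * M) - binEntropy M := by
  have hmono := binEntropy_strictMonoOn.monotoneOn
  have hinv : (2 : ℝ)⁻¹ = 1 / 2 := by norm_num
  rw [hinv] at hmono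
  have hM1 : 0 ≤ P * (1 - 2 * M) := mul_nonneg hP (by linarith)
  have hN1 : 0 ≤ (1 - 2 * P) * (1 - 2 * N) := mul_nonneg (by linarith) (by linarith)
  have hD : 0 ≤ (1 - 2 * P) * (N - M) := mul_nonneg (by linarith) (by linarith)
  have hD' : 0 ≤ P * (N - M) := mul_nonneg hP (by linarith)
  constructor
  · exact hmono ⟨by linarith, by linarith⟩ ⟨by linarith, by linarith⟩ (by linarith)
  · have h1 := strictConcave_binEntropy.concaveOn.add_le_add_of_add_eq
      (a := M) (b := P * (1 - M) + (1 - P) * M) (c := M + (1 - 2 * P) * (N - M))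
      (d := P * (1 - N) + (1 - P) * N)
      ⟨by linarith, by linarith⟩ ⟨by linarith, by linarith⟩ (by linarith) (by linarith) (by ring)
    have h2 : binEntropy (M + (1 - 2 * P) * (N - M)) ≤ binEntropy N :=
      hmono ⟨by linarith, by linarith⟩ ⟨by linarith, by linarith⟩ (by linarith)
    linarith

lemma binEntropy_conv {P M N : ℝ} (hP : P ∈ Set.Icc (0 : ℝ) 1) (hM : 0 ≤ M)
    (hMN : M ≤ N) (hN : N ≤ 1 / 2) :
    binEntropy (P * (1 - M) + (1 - P) * M) ≤ binEntropy (P * (1 - N) + (1 - P) * N) ∧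
      binEntropy (P * (1 - N) + (1 - P) * N) - binEntropy N ≤
        binEntropy (P * (1 - M) + (1 - P) * M) - binEntropy M := by
  rcases le_total P (1 / 2) with h | h
  · exact binEntropy_conv_of_le_half hP.1 h hM hMN hN
  · have := binEntropy_conv_of_le_half (P := 1 - P) (by linarith [hP.2]) (by linarith) hM hMN hN
    rwa [binEntropy_conv_one_sub, binEntropy_conv_one_sub] at this

/-- **Single-letter content of Theorem 4:**
for the binary state-dependent wiretap channel `Y = X ⊕ S ⊕ η₁`, `Z = X ⊕ S ⊕ η₂`
with crossover probabilities `N1, N2 ∈ (0, 1/2]` and state probability `Q`,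
the supremum over input probabilities `P ∈ [0,1]` of `I(X; Y | S) - I(X; Z | S)`
equals `max {0, h(N2) - h(N1)}`. -/
theorem binary_sdwc_capacity
    {Ω : Type*} [MeasurableSpace Ω] (μ : Measure Ω) [IsProbabilityMeasure μ]
    {N1 N2 Q : ℝ}
    (hN1 : 0 < N1) (hN1' : N1 ≤ 1/2) (hN2 : 0 < N2) (hN2' : N2 ≤ 1/2)
    (hQ : Q ∈ Set.Icc (0:ℝ) 1)
    (X S η₁ η₂ : ℝ → Ω → ZMod 2)
    (hX : ∀ P, Measurable (X P)) (hS : ∀ P, Measurable (S P))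
    (hη₁ : ∀ P, Measurable (η₁ P)) (hη₂ : ∀ P, Measurable (η₂ P))
    (hind : ∀ P ∈ Set.Icc (0:ℝ) 1, IndepFin4 μ (X P) (S P) (η₁ P) (η₂ P))
    (hPX : ∀ P ∈ Set.Icc (0:ℝ) 1, (μ ((X P) ⁻¹' {1})).toReal = P)
    (hPS : ∀ P ∈ Set.Icc (0:ℝ) 1, (μ ((S P) ⁻¹' {1})).toReal = Q)
    (hPη₁ : ∀ P ∈ Set.Icc (0:ℝ) 1, (μ ((η₁ P) ⁻¹' {1})).toReal = N1)
    (hPη₂ : ∀ P ∈ Set.Icc (0:ℝ) 1, (μ ((η₂ P) ⁻¹' {1})).toReal = N2) :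
    IsLUB
      ((fun P =>
          condMutInfo μ (X P) (fun ω => X P ω + S P ω + η₁ P ω) (S P)
            - condMutInfo μ (X P) (fun ω => X P ω + S P ω + η₂ P ω) (S P))
        '' Set.Icc (0:ℝ) 1)
      (max 0 (binEnt N2 - binEnt N1)) := by
  have hval : ∀ P ∈ Set.Icc (0:ℝ) 1,
      condMutInfo μ (X P) (fun ω => X P ω + S P ω + η₁ P ω) (S P)
        - condMutInfo μ (X P) (fun ω => X P ω + S P ω + η₂ P ω) (S P) =
      (binEntropy (P * (1 - N1) + (1 - P) * N1) - binEntropy N1) -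
        (binEntropy (P * (1 - N2) + (1 - P) * N2) - binEntropy N2) := by
    intro P hP
    have hi := hind P hP
    unfold IndepFin4 at hi
    rw [condMutInfo_add_noise μ (hX P) (hS P) (hη₁ P) ?_ (hPX P hP) (hPS P hP) (hPη₁ P hP),
      condMutInfo_add_noise μ (hX P) (hS P) (hη₂ P) ?_ (hPX P hP) (hPS P hP) (hPη₂ P hP),
      binEnt_eq_binEntropy]
    · intro x s e
      rw [measure_toReal_eq_add_of_zmod_two μ (hη₁ P), Set.inter_right_comm _ (η₂ P ⁻¹' {e}),
        Set.inter_right_comm _ (η₂ P ⁻¹' {e}), hi, hi]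
      simp only [ENNReal.toReal_mul, measure_preimage_zero_toReal μ (hη₁ P)]
      ring
    · intro x s e
      rw [measure_toReal_eq_add_of_zmod_two μ (hη₂ P), hi, hi]
      simp only [ENNReal.toReal_mul, measure_preimage_zero_toReal μ (hη₂ P)]
      ring
  rw [Set.image_congr hval, binEnt_eq_binEntropy]
  refine IsGreatest.isLUB ⟨?_, ?_⟩
  · rcases le_total N1 N2 with h | h
    · refine ⟨1 / 2, ⟨by norm_num, by norm_num⟩, ?_⟩
      have hle := (binEntropy_conv (P := 0) ⟨le_rfl, zero_le_one⟩ hN1.le h hN2').1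
      simp only [zero_mul, sub_zero, one_mul, zero_add] at hle
      have hhalf : ∀ N : ℝ, 1 / 2 * (1 - N) + (1 - 1 / 2) * N = 1 / 2 := fun N => by ring
      simp only [hhalf]
      rw [max_eq_right (by linarith)]
      ring
    · refine ⟨0, ⟨le_rfl, zero_le_one⟩, ?_⟩
      have hle := (binEntropy_conv (P := 0) ⟨le_rfl, zero_le_one⟩ hN2.le h hN1').1
      simp only [zero_mul, sub_zero, one_mul, zero_add] at hle ⊢
      rw [max_eq_left (by linarith)]
      ring
  · rintro _ ⟨P, hP, rfl⟩
    rcases le_total N1 N2 with h | h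
    · refine le_max_of_le_right ?_
      linarith [(binEntropy_conv hP hN1.le h hN2').1]
    · refine le_max_of_le_left ?_
      linarith [(binEntropy_conv hP hN2.le h hN1').2]
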